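/- (Theorem 2: bad data, good classifier.) Let D = (q_M, q_H, P_M, P_H) be a data distribution with joint text density P_D and posterior classifier p_D(x) = q_M·P_M(x)/P_D(x), with ∫ H(p_D(x))·P_D(x) dμ(x) finite. Let D̂ = (q_M, q_H, P̂_M, P̂_H) be a data distribution with joint text density P_D̂, consistent with a ground-truth function p̂ satisfying d(p̂(x)‖p_D(x)) = δ·P_D̂(x)/P_D(x) for all x ∈ X, where δ > 0, and suppose ∫ H(p̂(x))·P_D̂(x) dμ(x) is finite. Then every classifier f : X → (0,1) achieving optimal cross-entropy loss on D, i.e. L(f|D) = ∫ H(p_D(x))·P_D(x) dμ(x), has generalization gap L(f|D̂) − ∫ H(p̂(x))·P_D̂(x) dμ(x) = δ·(D_χ²(P_D̂‖P_D) + 1) ≥ δ·D_χ²(P_D̂‖P_D). -/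

import Mathlib

open MeasureTheory Real

/-- Binary entropy `H(p) = −p·log p − (1−p)·log(1−p)`. -/
noncomputable def binH (p : ℝ) : ℝ := -(p * Real.log p) - (1 - p) * Real.log (1 - p)

/-- Binary KL divergence `d(p‖q) = p·log(p/q) + (1−p)·log((1−p)/(1−q))`. -/
noncomputable def binKL (p q : ℝ) : ℝ :=
  p * Real.log (p / q) + (1 - p) * Real.log ((1 - p) / (1 - q))

/-- `log` bounded below by its tangent at `1`, scaled: `p - q ≤ p * log (p / q)`. -/
theorem sub_le_mul_log_div {p q : ℝ} (hp : 0 < p) (hq : 0 < q) :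
    p - q ≤ p * Real.log (p / q) := by
  have h := Real.log_le_sub_one_of_pos (div_pos hq hp)
  rw [← inv_div p q, Real.log_inv, inv_div] at h
  have h' := mul_le_mul_of_nonneg_left h hp.le
  have e : p * (q / p - 1) = q - p := by field_simp
  linarith

theorem sub_lt_mul_log_div {p q : ℝ} (hp : 0 < p) (hq : 0 < q) (hpq : p ≠ q) :
    p - q < p * Real.log (p / q) := by
  have h := Real.log_lt_sub_one_of_pos (div_pos hq hp)
    (fun h => hpq ((div_eq_one_iff_eq hp.ne').1 h).symm)
  rw [← inv_div p q, Real.log_inv, inv_div] at h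
  have h' := mul_lt_mul_of_pos_left h hp
  have e : p * (q / p - 1) = q - p := by field_simp
  linarith

/-- Gibbs' inequality for Bernoulli distributions. -/
theorem binKL_nonneg {p q : ℝ} (hp : p ∈ Set.Ioo (0 : ℝ) 1) (hq : q ∈ Set.Ioo (0 : ℝ) 1) :
    0 ≤ binKL p q := by
  have h₁ := sub_le_mul_log_div hp.1 hq.1
  have h₂ := sub_le_mul_log_div (sub_pos.2 hp.2) (sub_pos.2 hq.2)
  unfold binKL
  linarith

theorem eq_of_binKL_eq_zero {p q : ℝ} (hp : p ∈ Set.Ioo (0 : ℝ) 1)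
    (hq : q ∈ Set.Ioo (0 : ℝ) 1) (h : binKL p q = 0) : p = q := by
  by_contra hpq
  have h₁ := sub_lt_mul_log_div hp.1 hq.1 hpq
  have h₂ := sub_le_mul_log_div (sub_pos.2 hp.2) (sub_pos.2 hq.2)
  unfold binKL at h
  linarith

theorem binH_nonneg {p : ℝ} (hp : p ∈ Set.Ioo (0 : ℝ) 1) : 0 ≤ binH p := by
  have h₁ := mul_nonneg hp.1.le (neg_nonneg.2 (Real.log_nonpos hp.1.le hp.2.le))
  have h₂ := mul_nonneg (sub_pos.2 hp.2).le
    (neg_nonneg.2 (Real.log_nonpos (sub_pos.2 hp.2).le (by linarith [hp.1])))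
  unfold binH
  linarith

/-- Cross-entropy is entropy plus relative entropy. -/
theorem cross_entropy_eq_binH_add_binKL {p q : ℝ} (hp : p ∈ Set.Ioo (0 : ℝ) 1)
    (hq : q ∈ Set.Ioo (0 : ℝ) 1) :
    -(p * Real.log q + (1 - p) * Real.log (1 - q)) = binH p + binKL p q := by
  unfold binH binKL
  rw [Real.log_div hp.1.ne' hq.1.ne',
    Real.log_div (sub_pos.2 hp.2).ne' (sub_pos.2 hq.2).ne']
  ring

theorem div_add_mem_Ioo {a b : ℝ} (ha : 0 < a) (hb : 0 < b) :
    a / (a + b) ∈ Set.Ioo (0 : ℝ) 1 :=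
  ⟨by positivity, (div_lt_one (by positivity)).2 (by linarith)⟩

theorem weighted_cross_entropy_eq {a b q : ℝ} (ha : 0 < a) (hb : 0 < b)
    (hq : q ∈ Set.Ioo (0 : ℝ) 1) :
    -(a * Real.log q + b * Real.log (1 - q))
      = binH (a / (a + b)) * (a + b) + binKL (a / (a + b)) q * (a + b) := by
  rw [← add_mul, ← cross_entropy_eq_binH_add_binKL (div_add_mem_Ioo ha hb) hq]
  have := (add_pos ha hb).ne'
  field_simp
  ring

/-- A classifier attaining the entropy lower bound on the cross-entropy loss is almost everywhere
the posterior classifier. -/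
theorem ae_eq_posterior_of_lintegral_cross_entropy_eq {X : Type*} [MeasurableSpace X]
    {μ : Measure X} {a b f : X → ℝ} (ha : Measurable a) (hb : Measurable b)
    (ha0 : ∀ x, 0 < a x) (hb0 : ∀ x, 0 < b x)
    (hint : Integrable (fun x => binH (a x / (a x + b x)) * (a x + b x)) μ)
    (hf : Measurable f) (hf01 : ∀ x, f x ∈ Set.Ioo (0 : ℝ) 1)
    (hopt : ∫⁻ x, ENNReal.ofReal (-(a x * Real.log (f x) + b x * Real.log (1 - f x))) ∂μ
      = ENNReal.ofReal (∫ x, binH (a x / (a x + b x)) * (a x + b x) ∂μ)) :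
    ∀ᵐ x ∂μ, f x = a x / (a x + b x) := by
  have hs : ∀ x, 0 < a x + b x := fun x => add_pos (ha0 x) (hb0 x)
  have hp : ∀ x, a x / (a x + b x) ∈ Set.Ioo (0 : ℝ) 1 := fun x => div_add_mem_Ioo (ha0 x) (hb0 x)
  have hH : ∀ x, 0 ≤ binH (a x / (a x + b x)) * (a x + b x) := fun x =>
    mul_nonneg (binH_nonneg (hp x)) (hs x).le
  have hK : ∀ x, 0 ≤ binKL (a x / (a x + b x)) (f x) * (a x + b x) := fun x =>
    mul_nonneg (binKL_nonneg (hp x) (hf01 x)) (hs x).le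
  rw [ofReal_integral_eq_lintegral_ofReal hint (ae_of_all _ hH)] at hopt
  have hae := ae_eq_of_ae_le_of_lintegral_le
    (ae_of_all μ fun x => ENNReal.ofReal_le_ofReal
      (by rw [weighted_cross_entropy_eq (ha0 x) (hb0 x) (hf01 x)]; linarith [hK x]))
    (by
      rw [← ofReal_integral_eq_lintegral_ofReal hint (ae_of_all _ hH)]
      exact ENNReal.ofReal_ne_top)
    (by fun_prop) hopt.le
  filter_upwards [hae] with x hx
  rw [weighted_cross_entropy_eq (ha0 x) (hb0 x) (hf01 x),
    ENNReal.ofReal_eq_ofReal_iff (hH x) (add_nonneg (hH x) (hK x)), left_eq_add] at hx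
  exact (eq_of_binKL_eq_zero (hp x) (hf01 x)
    ((mul_eq_zero.1 hx).resolve_right (hs x).ne')).symm

/-- The Pearson `χ²` divergence of probability densities is nonnegative. -/
theorem one_le_lintegral_sq_div {X : Type*} [MeasurableSpace X] {μ : Measure X} {g h : X → ℝ}
    (hgm : Measurable g) (hg : ∀ x, 0 ≤ g x) (hh : ∀ x, 0 < h x)
    (hg1 : ∫ x, g x ∂μ = 1) (hh1 : ∫ x, h x ∂μ = 1) :
    1 ≤ ∫⁻ x, ENNReal.ofReal (g x ^ 2 / h x) ∂μ := by
  have hgi := integrable_of_integral_eq_one hg1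
  have hhi := integrable_of_integral_eq_one hh1
  have hgl : ∫⁻ x, ENNReal.ofReal (g x) ∂μ = 1 := by
    rw [← ofReal_integral_eq_lintegral_ofReal hgi (ae_of_all _ hg), hg1, ENNReal.ofReal_one]
  have hhl : ∫⁻ x, ENNReal.ofReal (h x) ∂μ = 1 := by
    rw [← ofReal_integral_eq_lintegral_ofReal hhi (ae_of_all _ fun x => (hh x).le), hh1,
      ENNReal.ofReal_one]
  have hle : ∫⁻ x, ENNReal.ofReal (g x) + ENNReal.ofReal (g x) ∂μ
      ≤ ∫⁻ x, ENNReal.ofReal (h x) + ENNReal.ofReal (g x ^ 2 / h x) ∂μ := by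
    refine lintegral_mono fun x => ?_
    have hx := hh x
    rw [← ENNReal.ofReal_add (hg x) (hg x), ← ENNReal.ofReal_add hx.le (by positivity)]
    refine ENNReal.ofReal_le_ofReal ?_
    have e : h x + g x ^ 2 / h x - (g x + g x) = (g x - h x) ^ 2 / h x := by
      field_simp
      ring
    have : 0 ≤ (g x - h x) ^ 2 / h x := by positivity
    linarith
  rw [lintegral_add_left hgm.ennreal_ofReal, lintegral_add_left' hhi.aemeasurable.ennreal_ofReal,
    hgl, hhl] at hle
  exact (ENNReal.add_le_add_iff_left ENNReal.one_ne_top).1 hle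

/-- Theorem 2: bad data, good classifier: let `D` be a data distribution
with posterior classifier `p_D x = qM·PM x / P_D x` and `∫ H(p_D)·P_D dμ` finite, and
let `D̂` be a data distribution consistent with a ground-truth function `phat`
satisfying `d(phat x ‖ p_D x) = δ·P_D̂ x / P_D x` for all `x` (with `δ > 0`), with
`∫ H(phat)·P_D̂ dμ` finite. Then every classifier `f` achieving optimal cross-entropy
loss on `D` has generalization gap
`L(f|D̂) − ∫ H(phat)·P_D̂ dμ = δ·(D_χ²(P_D̂‖P_D) + 1) ≥ δ·D_χ²(P_D̂‖P_D)`.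
Losses and the possibly-infinite integrals are taken in `ℝ≥0∞`, where
`D_χ²(P_D̂‖P_D) = ∫⁻ P_D̂²/P_D dμ − 1`. -/
theorem bad_data_good_classifier
    {X : Type*} [MeasurableSpace X] (μ : Measure X) [SigmaFinite μ]
    (qM qH : ℝ) (PM PH PMh PHh phat : X → ℝ) (δ : ℝ)
    (hqM : qM ∈ Set.Ioo (0 : ℝ) 1) (hqH : qH ∈ Set.Ioo (0 : ℝ) 1) (hq : qM + qH = 1)
    (hPMmeas : Measurable PM) (hPHmeas : Measurable PH)
    (hPMpos : ∀ x, 0 < PM x) (hPHpos : ∀ x, 0 < PH x)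
    (hPMone : ∫ x, PM x ∂μ = 1) (hPHone : ∫ x, PH x ∂μ = 1)
    (hPMhmeas : Measurable PMh) (hPHhmeas : Measurable PHh)
    (hPMhpos : ∀ x, 0 < PMh x) (hPHhpos : ∀ x, 0 < PHh x)
    (hPMhone : ∫ x, PMh x ∂μ = 1) (hPHhone : ∫ x, PHh x ∂μ = 1)
    (hHfin : Integrable (fun x =>
      binH (qM * PM x / (qM * PM x + qH * PH x)) * (qM * PM x + qH * PH x)) μ)
    (hphatmeas : Measurable phat) (hphat : ∀ x, phat x ∈ Set.Ioo (0 : ℝ) 1)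
    (hconsh : ∀ x, qM * PMh x * (1 - phat x) = qH * PHh x * phat x)
    (hδ : 0 < δ)
    (hd : ∀ x, binKL (phat x) (qM * PM x / (qM * PM x + qH * PH x))
      = δ * (qM * PMh x + qH * PHh x) / (qM * PM x + qH * PH x))
    (hHhfin : Integrable (fun x => binH (phat x) * (qM * PMh x + qH * PHh x)) μ) :
    ∀ f : X → ℝ, Measurable f → (∀ x, f x ∈ Set.Ioo (0 : ℝ) 1) →
      (∫⁻ x, ENNReal.ofReal
            (-(qM * PM x * Real.log (f x) + qH * PH x * Real.log (1 - f x))) ∂μ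
          = ENNReal.ofReal (∫ x,
              binH (qM * PM x / (qM * PM x + qH * PH x))
                * (qM * PM x + qH * PH x) ∂μ)) →
      ((∫⁻ x, ENNReal.ofReal
            (-(qM * PMh x * Real.log (f x) + qH * PHh x * Real.log (1 - f x))) ∂μ)
          - ENNReal.ofReal (∫ x, binH (phat x) * (qM * PMh x + qH * PHh x) ∂μ)
        = ENNReal.ofReal δ
            * ((∫⁻ x, ENNReal.ofReal
                ((qM * PMh x + qH * PHh x) ^ 2 / (qM * PM x + qH * PH x)) ∂μ) - 1 + 1))
      ∧ ENNReal.ofReal δ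
            * ((∫⁻ x, ENNReal.ofReal
                ((qM * PMh x + qH * PHh x) ^ 2 / (qM * PM x + qH * PH x)) ∂μ) - 1)
          ≤ (∫⁻ x, ENNReal.ofReal
              (-(qM * PMh x * Real.log (f x) + qH * PHh x * Real.log (1 - f x))) ∂μ)
            - ENNReal.ofReal (∫ x, binH (phat x) * (qM * PMh x + qH * PHh x) ∂μ) := by
  intro f hf hf01 hopt
  have ha0 : ∀ x, 0 < qM * PM x := fun x => mul_pos hqM.1 (hPMpos x)
  have hb0 : ∀ x, 0 < qH * PH x := fun x => mul_pos hqH.1 (hPHpos x)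
  have hah0 : ∀ x, 0 < qM * PMh x := fun x => mul_pos hqM.1 (hPMhpos x)
  have hbh0 : ∀ x, 0 < qH * PHh x := fun x => mul_pos hqH.1 (hPHhpos x)
  have hmix : ∀ {P Q : X → ℝ}, ∫ x, P x ∂μ = 1 → ∫ x, Q x ∂μ = 1 →
      ∫ x, (qM * P x + qH * Q x) ∂μ = 1 := fun {P Q} hP hQ => by
    rw [integral_add ((integrable_of_integral_eq_one hP).const_mul qM)
      ((integrable_of_integral_eq_one hQ).const_mul qH), integral_const_mul, integral_const_mul,
      hP, hQ, mul_one, mul_one, hq]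
  have hpost : ∀ x, phat x = qM * PMh x / (qM * PMh x + qH * PHh x) := fun x => by
    rw [eq_div_iff (add_pos (hah0 x) (hbh0 x)).ne']
    linarith [hconsh x]
  have hfae := ae_eq_posterior_of_lintegral_cross_entropy_eq (hPMmeas.const_mul qM)
    (hPHmeas.const_mul qH) ha0 hb0 hHfin hf hf01 hopt
  have hH : ∀ x, 0 ≤ binH (phat x) * (qM * PMh x + qH * PHh x) := fun x =>
    mul_nonneg (binH_nonneg (hphat x)) (add_pos (hah0 x) (hbh0 x)).le
  have hloss : ∫⁻ x, ENNReal.ofReal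
        (-(qM * PMh x * Real.log (f x) + qH * PHh x * Real.log (1 - f x))) ∂μ
      = ∫⁻ x, ENNReal.ofReal (binH (phat x) * (qM * PMh x + qH * PHh x))
          + ENNReal.ofReal δ * ENNReal.ofReal
            ((qM * PMh x + qH * PHh x) ^ 2 / (qM * PM x + qH * PH x)) ∂μ := by
    refine lintegral_congr_ae ?_
    filter_upwards [hfae] with x hx
    have hs := add_pos (ha0 x) (hb0 x)
    rw [← ENNReal.ofReal_mul hδ.le, ← ENNReal.ofReal_add (hH x) (by positivity),
      weighted_cross_entropy_eq (hah0 x) (hbh0 x) (hf01 x), ← hpost x, hx, hd x]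
    congr 2
    ring
  have hgap : (∫⁻ x, ENNReal.ofReal
        (-(qM * PMh x * Real.log (f x) + qH * PHh x * Real.log (1 - f x))) ∂μ)
        - ENNReal.ofReal (∫ x, binH (phat x) * (qM * PMh x + qH * PHh x) ∂μ)
      = ENNReal.ofReal δ * ∫⁻ x, ENNReal.ofReal
          ((qM * PMh x + qH * PHh x) ^ 2 / (qM * PM x + qH * PH x)) ∂μ := by
    rw [hloss, lintegral_add_left' hHhfin.aemeasurable.ennreal_ofReal,
      lintegral_const_mul' _ _ ENNReal.ofReal_ne_top,
      ← ofReal_integral_eq_lintegral_ofReal hHhfin (ae_of_all _ hH),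
      ENNReal.add_sub_cancel_left ENNReal.ofReal_ne_top]
  have hone : 1 ≤ ∫⁻ x, ENNReal.ofReal
      ((qM * PMh x + qH * PHh x) ^ 2 / (qM * PM x + qH * PH x)) ∂μ :=
    one_le_lintegral_sq_div (by fun_prop) (fun x => (add_pos (hah0 x) (hbh0 x)).le)
      (fun x => add_pos (ha0 x) (hb0 x)) (hmix hPMhone hPHhone) (hmix hPMone hPHone)
  rw [hgap, tsub_add_cancel_of_le hone]
  exact ⟨rfl, mul_le_mul_right tsub_le_self _⟩
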